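/- arXiv:2601.09934 — 5 statements merged into one kernel-verified Lean document; each statement's English description precedes it below -/
import Mathlib

section
/- The Wigner transformation is an L² isometry: for every f ∈ S(ℝ²), ∫_{ℝ²} |(Wf)(x,y)|² dx dy = ∫_{ℝ²} |f(q,p)|² dq dp (hence W extends to a unitary operator on L²(ℝ²)). -/
noncomputable section

open MeasureTheory

/-- The Wigner transformation
`(Wf)(x,y) = (2π)^{-1/2} ∫ f((x+y)/√2, z) e^{i(x-y)z/√2} dz`. -/
def wigI (f : ℝ × ℝ → ℂ) (x : ℝ × ℝ) : ℂ :=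
  (((Real.sqrt (2 * Real.pi))⁻¹ : ℝ) : ℂ) *
    ∫ z : ℝ, f ((x.1 + x.2) / Real.sqrt 2, z) *
      Complex.exp (Complex.I * (((x.1 - x.2) * z / Real.sqrt 2 : ℝ) : ℂ))

open scoped FourierTransform

/-- The partial Fourier transform in the second variable. -/
def wigF (f : ℝ × ℝ → ℂ) (p : ℝ × ℝ) : ℂ :=
  (((Real.sqrt (2 * Real.pi))⁻¹ : ℝ) : ℂ) *
    ∫ z : ℝ, f (p.1, z) * Complex.exp (Complex.I * ((p.2 * z : ℝ) : ℂ))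

/-- The rotation/reflection of the plane. -/
def wigT : ℝ × ℝ →ₗ[ℝ] ℝ × ℝ :=
  Matrix.toLin (Module.Basis.finTwoProd ℝ) (Module.Basis.finTwoProd ℝ)
    !![(Real.sqrt 2)⁻¹, (Real.sqrt 2)⁻¹; (Real.sqrt 2)⁻¹, -(Real.sqrt 2)⁻¹]

theorem wigT_apply (u : ℝ × ℝ) :
    wigT u = ((u.1 + u.2) / Real.sqrt 2, (u.1 - u.2) / Real.sqrt 2) := by
  rw [wigT, Matrix.toLin_finTwoProd_apply]
  ext <;> simp <;> ring

theorem wigT_det : LinearMap.det wigT = -1 := by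
  rw [wigT, LinearMap.det_toLin, Matrix.det_fin_two_of]
  have h : (Real.sqrt 2)⁻¹ * (Real.sqrt 2)⁻¹ = 1 / 2 := by
    rw [← mul_inv, Real.mul_self_sqrt (by norm_num)]; norm_num
  linarith

theorem wigT_mp : MeasurePreserving (fun u => wigT u) (volume : Measure (ℝ × ℝ)) volume := by
  refine ⟨(LinearMap.continuous_of_finiteDimensional wigT).measurable, ?_⟩
  have := Measure.map_linearMap_addHaar_eq_smul_addHaar (volume : Measure (ℝ × ℝ)) (f := wigT)
    (by rw [wigT_det]; norm_num)
  rw [this, wigT_det]; simp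

theorem wigI_eq (f : ℝ × ℝ → ℂ) (u : ℝ × ℝ) : wigI f u = wigF f (wigT u) := by
  rw [wigT_apply, wigI, wigF]
  congr 2
  ext z
  congr 4
  ring

theorem wigF_meas (f : ℝ × ℝ → ℂ) (hf : Continuous f) : Measurable (wigF f) := by
  unfold wigF
  refine Measurable.const_mul ?_ _
  refine StronglyMeasurable.measurable ?_
  refine StronglyMeasurable.integral_prod_right
    (f := fun (p : ℝ × ℝ) (z : ℝ) =>
      f (p.1, z) * Complex.exp (Complex.I * ((p.2 * z : ℝ) : ℂ))) ?_
  refine Continuous.stronglyMeasurable ?_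
  unfold Function.uncurry
  fun_prop

/-- The slice of a Schwartz function. -/
def wigSlice (f : SchwartzMap (ℝ × ℝ) ℂ) (q : ℝ) : SchwartzMap ℝ ℂ :=
  SchwartzMap.compCLM ℂ (g := fun z : ℝ => (q, z))
    (by
      have h : (fun z : ℝ => (q, z)) =
          (fun z : ℝ => (ContinuousLinearMap.inr ℝ ℝ ℝ) z + (q, 0)) := by
        ext z <;> simp
      rw [h]
      exact (ContinuousLinearMap.hasTemperateGrowth _).add (.const _))
    ⟨1, 1, fun x => by
      have : ‖x‖ ≤ ‖(q, x)‖ := norm_snd_le (q, x)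
      simp only [pow_one, one_mul]
      linarith⟩ f

theorem wigSlice_apply (f : SchwartzMap (ℝ × ℝ) ℂ) (q z : ℝ) : wigSlice f q z = f (q, z) := rfl

theorem wigF_slice (f : SchwartzMap (ℝ × ℝ) ℂ) (q w : ℝ) :
    ‖wigF f (q, w)‖ ^ 2 =
      (2 * Real.pi)⁻¹ * ‖(𝓕 (wigSlice f q)) (-(2 * Real.pi)⁻¹ * w)‖ ^ 2 := by
  rw [wigF, norm_mul, mul_pow, SchwartzMap.fourier_coe, Real.fourier_real_eq_integral_exp_smul]
  congr 1
  · rw [Complex.norm_real, Real.norm_eq_abs, sq_abs, inv_pow, Real.sq_sqrt (by positivity)]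
  · congr 3
    ext z
    rw [smul_eq_mul, mul_comm, wigSlice_apply]
    congr 2
    rw [mul_comm]
    congr 2
    have := Real.pi_ne_zero
    field_simp

theorem wig_sq_int (g : SchwartzMap ℝ ℂ) : Integrable (fun z => ‖g z‖ ^ 2) :=
  (g.memLp 2).integrable_norm_pow (by norm_num)

theorem wig_slice_lintegral (f : SchwartzMap (ℝ × ℝ) ℂ) (q : ℝ) :
    ∫⁻ w, ENNReal.ofReal (‖wigF f (q, w)‖ ^ 2) = ∫⁻ z, ENNReal.ofReal (‖f (q, z)‖ ^ 2) := by
  have hpi := Real.pi_pos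
  have h1 := wig_sq_int (wigSlice f q)
  have h2 : Integrable (fun w => ‖wigF f (q, w)‖ ^ 2) := by
    simp_rw [wigF_slice]
    exact ((wig_sq_int (𝓕 (wigSlice f q))).comp_mul_left' (R := -(2 * Real.pi)⁻¹)
      (by simp [hpi.ne'])).const_mul _
  simp_rw [← wigSlice_apply]
  rw [← ofReal_integral_eq_lintegral_ofReal h1 (ae_of_all _ fun _ => by positivity),
    ← ofReal_integral_eq_lintegral_ofReal h2 (ae_of_all _ fun _ => by positivity)]
  congr 1
  simp_rw [wigF_slice]
  rw [integral_const_mul,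
    Measure.integral_comp_mul_left (fun w => ‖(𝓕 (wigSlice f q) : SchwartzMap ℝ ℂ) w‖ ^ 2),
    SchwartzMap.integral_norm_sq_fourier, smul_eq_mul, ← mul_assoc]
  have : (2 * Real.pi)⁻¹ * |(-(2 * Real.pi)⁻¹)⁻¹| = 1 := by
    rw [abs_inv, abs_neg, abs_of_pos (by positivity), inv_inv]
    field_simp
  rw [this, one_mul]

/-- the Wigner transformation is an `L²` isometry on Schwartz
functions: `∫ |Wf|² = ∫ |f|²`. -/
theorem wigner_L2_isometry (f : SchwartzMap (ℝ × ℝ) ℂ) :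
    ∫ u : ℝ × ℝ, ‖wigI (⇑f) u‖ ^ 2 = ∫ u : ℝ × ℝ, ‖f u‖ ^ 2 := by
  have hF := wigF_meas f f.continuous
  have hF2 : Measurable fun p => ENNReal.ofReal (‖wigF f p‖ ^ 2) := by fun_prop
  have hf2 : Measurable fun p => ENNReal.ofReal (‖f p‖ ^ 2) := by
    have := f.continuous.measurable
    fun_prop
  have hT := wigT_mp.measurable
  have hG : Measurable fun u => ‖wigF f (wigT u)‖ ^ 2 := (hF.comp hT).norm.pow_const 2
  simp_rw [wigI_eq]
  rw [integral_eq_lintegral_of_nonneg_ae (ae_of_all _ fun _ => by positivity)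
      hG.aestronglyMeasurable,
    integral_eq_lintegral_of_nonneg_ae (ae_of_all _ fun _ => by positivity)
      (f.continuous.measurable.norm.pow_const 2).aestronglyMeasurable,
    wigT_mp.lintegral_comp hF2, Measure.volume_eq_prod, lintegral_prod _ hF2.aemeasurable,
    lintegral_prod _ hf2.aemeasurable]
  simp_rw [wig_slice_lintegral]
end
end

section
/- Reduction lemma: for every tempered distribution R ∈ S'(ℝ) and every f ∈ S(ℝ²), the function y ↦ f(x,y) belongs to S(ℝ) for each fixed x ∈ ℝ, the function x ↦ R(f(x,·)) belongs to S(ℝ), and the resulting linear map S(ℝ²) → S(ℝ), f ↦ (x ↦ R(f(x,·))), is continuous. -/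
noncomputable section

open MeasureTheory

open scoped ContDiff LineDeriv SchwartzMap Topology

namespace RedLem

abbrev S2 := SchwartzMap (ℝ × ℝ) ℂ
abbrev S1 := SchwartzMap ℝ ℂ

/-- partial derivative in the first variable -/
def d1 : S2 →L[ℂ] S2 := LineDeriv.lineDerivOpCLM ℂ S2 ((1, 0) : ℝ × ℝ)
/-- partial derivative in the second variable -/
def d2 : S2 →L[ℂ] S2 := LineDeriv.lineDerivOpCLM ℂ S2 ((0, 1) : ℝ × ℝ)

lemma d1_apply (f : S2) (p : ℝ × ℝ) : d1 f p = fderiv ℝ f p (1, 0) := rfl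
lemma d2_apply (f : S2) (p : ℝ × ℝ) : d2 f p = fderiv ℝ f p (0, 1) := rfl

lemma hasDerivAt_fst (f : S2) (x y : ℝ) : HasDerivAt (fun t => f (t, y)) (d1 f (x, y)) x :=
  (f.hasFDerivAt (x, y)).comp_hasDerivAt x ((hasDerivAt_id x).prodMk (hasDerivAt_const x y))

lemma hasDerivAt_snd (f : S2) (x y : ℝ) : HasDerivAt (fun t => f (x, t)) (d2 f (x, y)) y :=
  (f.hasFDerivAt (x, y)).comp_hasDerivAt y ((hasDerivAt_const y x).prodMk (hasDerivAt_id y))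

lemma d1_d2 (f : S2) : d1 (d2 f) = d2 (d1 f) := by
  ext p
  have hs : IsSymmSndFDerivAt ℝ f p :=
    (f.contDiffAt 2).isSymmSndFDerivAt (by simp)
  have hd : DifferentiableAt ℝ (fderiv ℝ f) p :=
    (SchwartzMap.fderivCLM ℝ (ℝ × ℝ) ℂ f).differentiableAt
  have key (u v : ℝ × ℝ) : fderiv ℝ (fun q => fderiv ℝ f q u) p v
      = fderiv ℝ (fderiv ℝ f) p v u := by
    rw [fderiv_clm_apply hd (differentiableAt_const u)]
    simp
  have h1 : d1 (d2 f) p = fderiv ℝ (fun q => fderiv ℝ f q (0, 1)) p (1, 0) := rfl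
  have h2 : d2 (d1 f) p = fderiv ℝ (fun q => fderiv ℝ f q (1, 0)) p (0, 1) := rfl
  rw [h1, h2, key, key]
  exact hs _ _

lemma d1_d2_pow (n : ℕ) (f : S2) : d1 ((d2 ^ n) f) = (d2 ^ n) (d1 f) := by
  have : Commute d1 d2 := by
    ext1 f
    exact d1_d2 f
  exact congrArg (fun T : S2 →L[ℂ] S2 => T f) (this.pow_right n).eq

/-- the slice map -/
def slice (x : ℝ) : S2 →L[ℂ] S1 :=
  SchwartzMap.compCLM ℂ (g := fun y : ℝ => (x, y))
    (by
      have h : (fun y : ℝ => ((x, y) : ℝ × ℝ)) =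
          (fun _ : ℝ => ((x, 0) : ℝ × ℝ)) + ⇑(ContinuousLinearMap.inr ℝ ℝ ℝ) := by
        ext y <;> simp
      rw [h]
      exact (Function.HasTemperateGrowth.const _).add
        (ContinuousLinearMap.inr ℝ ℝ ℝ).hasTemperateGrowth)
    ⟨1, 1, fun y => by
      have : ‖y‖ ≤ ‖((x, y) : ℝ × ℝ)‖ := norm_snd_le (x, y)
      simp only [pow_one, one_mul]
      linarith⟩

lemma slice_apply (x y : ℝ) (f : S2) : slice x f y = f (x, y) := rfl

lemma iteratedDeriv_slice (n : ℕ) (x : ℝ) (f : S2) :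
    iteratedDeriv n (slice x f) = slice x ((d2 ^ n) f) := by
  induction n with
  | zero => simp
  | succ n ih =>
    rw [iteratedDeriv_succ, ih]
    ext y
    rw [pow_succ']
    exact (hasDerivAt_snd _ x y).deriv

lemma pow_bound (j k : ℕ) (x y : ℝ) (f : S2) :
    |x| ^ j * (|y| ^ k * ‖f (x, y)‖) ≤ SchwartzMap.seminorm ℂ (j + k) 0 f := by
  refine le_trans ?_ (SchwartzMap.norm_pow_mul_le_seminorm ℂ f (j + k) (x, y))
  rw [pow_add, mul_assoc]
  have h1 : |x| ≤ ‖((x, y) : ℝ × ℝ)‖ := norm_fst_le (x, y)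
  have h2 : |y| ≤ ‖((x, y) : ℝ × ℝ)‖ := norm_snd_le (x, y)
  gcongr

lemma seminorm_slice (j k n : ℕ) (x : ℝ) (f : S2) :
    |x| ^ j * SchwartzMap.seminorm ℂ k n (slice x f) ≤
      SchwartzMap.seminorm ℂ (j + k) 0 ((d2 ^ n) f) := by
  have h : SchwartzMap.seminorm ℂ k n ((((|x| ^ j : ℝ) : ℂ)) • slice x f) ≤
      SchwartzMap.seminorm ℂ (j + k) 0 ((d2 ^ n) f) := by
    rw [← map_smul]
    refine SchwartzMap.seminorm_le_bound' ℂ k n _ (apply_nonneg _ _) fun y => ?_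
    rw [iteratedDeriv_slice, slice_apply, map_smul, smul_apply, norm_smul]
    have := pow_bound j k x y ((d2 ^ n) f)
    simp only [Complex.norm_real, norm_pow, Real.norm_eq_abs, abs_abs]
    linarith
  rw [map_smul_eq_mul] at h
  simpa using h

lemma taylor_bound (φ φ1 φ2 : ℝ → ℂ) (h1 : ∀ t, HasDerivAt φ (φ1 t) t)
    (h2 : ∀ t, HasDerivAt φ1 (φ2 t) t) (M : ℝ) (hM : ∀ t, ‖φ2 t‖ ≤ M) (x h : ℝ) :
    ‖φ (x + h) - φ x - (h : ℂ) * φ1 x‖ ≤ M * |h| ^ 2 := by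
  have hM0 : 0 ≤ M := (norm_nonneg _).trans (hM 0)
  have A (t : ℝ) : ‖φ1 t - φ1 x‖ ≤ M * ‖t - x‖ :=
    convex_univ.norm_image_sub_le_of_norm_hasDerivWithin_le
      (fun t _ => (h2 t).hasDerivWithinAt) (fun t _ => hM t) trivial trivial
  have hψ (t : ℝ) : HasDerivAt (fun t : ℝ => φ t - (t : ℂ) * φ1 x) (φ1 t - φ1 x) t := by
    have h3 : HasDerivAt (fun t : ℝ => (t : ℂ) * φ1 x) (1 * φ1 x) t :=
      ((hasDerivAt_id t).ofReal_comp).mul_const _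
    rw [one_mul] at h3
    exact (h1 t).sub h3
  have B := (convex_uIcc x (x + h)).norm_image_sub_le_of_norm_hasDerivWithin_le
      (C := M * |h|)
      (fun t _ => (hψ t).hasDerivWithinAt) (fun t ht => (A t).trans (by
        have := Set.abs_sub_left_of_mem_uIcc ht
        rw [add_sub_cancel_left] at this
        rw [Real.norm_eq_abs]
        gcongr)) Set.left_mem_uIcc Set.right_mem_uIcc
  have e : φ (x + h) - φ x - (h : ℂ) * φ1 x =
      (φ (x + h) - ((x + h : ℝ) : ℂ) * φ1 x) - (φ x - (x : ℂ) * φ1 x) := by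
    push_cast
    ring
  rw [e]
  refine B.trans (le_of_eq ?_)
  rw [add_sub_cancel_left, Real.norm_eq_abs]
  ring

lemma seminorm_diff (k n : ℕ) (x h : ℝ) (f : S2) :
    SchwartzMap.seminorm ℂ k n (slice (x + h) f - slice x f - (h : ℂ) • slice x (d1 f)) ≤
      SchwartzMap.seminorm ℂ k 0 (d1 (d1 ((d2 ^ n) f))) * |h| ^ 2 := by
  refine SchwartzMap.seminorm_le_bound' ℂ k n _ (by positivity) fun y => ?_
  set g := (d2 ^ n) f with hg
  have e : iteratedDeriv n (slice (x + h) f - slice x f - (h : ℂ) • slice x (d1 f)) y =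
      g (x + h, y) - g (x, y) - (h : ℂ) * d1 g (x, y) := by
    have c (u : S1) : ContDiffAt ℝ n u y := u.contDiffAt n
    have e1 : ((slice (x + h) f - slice x f - (h : ℂ) • slice x (d1 f) : S1) : ℝ → ℂ) =
      (slice (x + h) f : ℝ → ℂ) - slice x f - ((slice x ((h : ℂ) • d1 f) : S1) : ℝ → ℂ) := rfl
    rw [e1, iteratedDeriv_sub (f := ⇑(slice (x + h) f) - ⇑(slice x f)) ((c _).sub (c _)) (c _),
      iteratedDeriv_sub (c _) (c _)]
    simp only [iteratedDeriv_slice, slice_apply]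
    simp only [hg, map_smul, ← d1_d2_pow, smul_apply, smul_eq_mul]
  change |y| ^ k * ‖iteratedDeriv n (slice (x + h) f - slice x f - (h : ℂ) • slice x (d1 f)) y‖ ≤ _
  rw [e]
  have T := taylor_bound (fun t => ((y : ℂ) ^ k) * g (t, y)) (fun t => ((y : ℂ) ^ k) * d1 g (t, y))
    (fun t => ((y : ℂ) ^ k) * d1 (d1 g) (t, y))
    (fun t => (hasDerivAt_fst g t y).const_mul _) (fun t => (hasDerivAt_fst (d1 g) t y).const_mul _)
    (SchwartzMap.seminorm ℂ k 0 (d1 (d1 g))) (fun t => by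
      have := pow_bound 0 k t y (d1 (d1 g))
      simpa using this) x h
  refine le_trans (le_of_eq ?_) T
  have : |y| ^ k = ‖(y : ℂ) ^ k‖ := by simp
  rw [this, ← norm_mul]
  congr 1
  ring

lemma R_bound (R : S1 →L[ℂ] ℂ) : ∃ (s : Finset (ℕ × ℕ)) (C : ℝ), 0 ≤ C ∧
    ∀ g : S1, ‖R g‖ ≤ C * ∑ i ∈ s, SchwartzMap.seminorm ℂ i.1 i.2 g := by
  obtain ⟨s, C, -, h⟩ := Seminorm.bound_of_continuous (schwartz_withSeminorms ℂ ℝ ℂ)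
    ((normSeminorm ℂ ℂ).comp R.toLinearMap) (R.continuous.norm)
  refine ⟨s, C, C.2, fun g => ?_⟩
  have h1 := h g
  have h2 := Seminorm.finset_sup_le_sum (schwartzSeminormFamily ℂ ℝ ℂ) s g
  have h3 : (∑ i ∈ s, schwartzSeminormFamily ℂ ℝ ℂ i) g =
      ∑ i ∈ s, SchwartzMap.seminorm ℂ i.1 i.2 g := by
    simp [schwartzSeminormFamily]
  rw [h3] at h2
  refine h1.trans ?_
  change (C : ℝ) * _ ≤ _
  exact mul_le_mul_of_nonneg_left h2 C.2

lemma hasDerivAt_R (R : S1 →L[ℂ] ℂ) (f : S2) (x : ℝ) :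
    HasDerivAt (fun x => R (slice x f)) (R (slice x (d1 f))) x := by
  obtain ⟨s, C, hC, hR⟩ := R_bound R
  rw [hasDerivAt_iff_isLittleO_nhds_zero]
  refine Asymptotics.IsBigO.trans_isLittleO (g := fun h : ℝ => h ^ 2) ?_ ?_
  · refine Asymptotics.IsBigO.of_bound
      (C * ∑ i ∈ s, SchwartzMap.seminorm ℂ i.1 0 (d1 (d1 ((d2 ^ i.2) f))))
      (Filter.Eventually.of_forall fun h => ?_)
    have e : R (slice (x + h) f) - R (slice x f) - h • R (slice x (d1 f)) =
        R (slice (x + h) f - slice x f - (h : ℂ) • slice x (d1 f)) := by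
      simp
    rw [e, norm_pow, Real.norm_eq_abs, mul_assoc, Finset.sum_mul]
    refine (hR _).trans ?_
    gcongr with i hi
    exact seminorm_diff _ _ _ _ _
  · exact Asymptotics.isLittleO_pow_id one_lt_two

lemma iteratedDeriv_R (R : S1 →L[ℂ] ℂ) (m : ℕ) (f : S2) :
    iteratedDeriv m (fun x => R (slice x f)) = fun x => R (slice x ((d1 ^ m) f)) := by
  induction m with
  | zero => simp
  | succ n ih =>
    rw [iteratedDeriv_succ, ih]
    ext y
    rw [pow_succ']
    exact (hasDerivAt_R R _ y).deriv

lemma contDiff_R (R : S1 →L[ℂ] ℂ) (f : S2) : ContDiff ℝ ∞ (fun x => R (slice x f)) := by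
  refine contDiff_of_differentiable_iteratedDeriv fun m _ => ?_
  rw [iteratedDeriv_R]
  exact fun x => (hasDerivAt_R R _ x).differentiableAt

lemma bound_R (R : S1 →L[ℂ] ℂ) (j m : ℕ) :
    ∃ (s : Finset (ℕ × ℕ)) (C : ℝ), 0 ≤ C ∧ ∀ (f : S2) (x : ℝ),
      ‖x‖ ^ j * ‖iteratedFDeriv ℝ m (fun x => R (slice x f)) x‖ ≤
        C * s.sup (schwartzSeminormFamily ℂ (ℝ × ℝ) ℂ) f := by
  obtain ⟨s, C, hC, hR⟩ := R_bound R
  let T (i : ℕ × ℕ) : S2 →L[ℂ] S2 := (d2 ^ i.2) * (d1 ^ m)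
  let Q : Seminorm ℂ S2 :=
    ∑ i ∈ s, (SchwartzMap.seminorm ℂ (j + i.1) 0).comp (T i).toLinearMap
  have hQ (f : S2) : Q f = ∑ i ∈ s, SchwartzMap.seminorm ℂ (j + i.1) 0 (T i f) := by
    simp [Q]
  have hcont : Continuous Q := by
    have : (Q : S2 → ℝ) = fun f => ∑ i ∈ s, SchwartzMap.seminorm ℂ (j + i.1) 0 (T i f) :=
      funext hQ
    rw [this]
    refine continuous_finsetSum _ fun i _ => ?_
    exact ((schwartz_withSeminorms ℂ (ℝ × ℝ) ℂ).continuous_seminorm (j + i.1, 0)).comp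
      (T i).continuous
  obtain ⟨s', C', -, h'⟩ := Seminorm.bound_of_continuous (schwartz_withSeminorms ℂ (ℝ × ℝ) ℂ) Q hcont
  refine ⟨s', C * C', by positivity, fun f x => ?_⟩
  rw [norm_iteratedFDeriv_eq_norm_iteratedDeriv, iteratedDeriv_R, Real.norm_eq_abs, mul_assoc]
  have h1 : Q f ≤ C' * s'.sup (schwartzSeminormFamily ℂ (ℝ × ℝ) ℂ) f := h' f
  refine le_trans ?_ (mul_le_mul_of_nonneg_left h1 hC)
  refine (mul_le_mul_of_nonneg_left (hR _) (by positivity)).trans ?_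
  rw [mul_left_comm, Finset.mul_sum, hQ]
  gcongr with i hi
  exact seminorm_slice j i.1 i.2 x ((d1 ^ m) f)

def L (R : S1 →L[ℂ] ℂ) : S2 →L[ℂ] S1 :=
  SchwartzMap.mkCLM (fun f x => R (slice x f)) (fun f g x => by simp) (fun a f x => by simp)
    (contDiff_R R) (fun n => bound_R R n.1 n.2)

end RedLem

/-- reduction lemma: for every tempered distribution
`R ∈ S'(ℝ)` and every `f ∈ S(ℝ²)`, each slice `y ↦ f(x,y)` belongs to `S(ℝ)`,
and the map `f ↦ (x ↦ R(f(x,·)))` is a continuous linear map `S(ℝ²) → S(ℝ)`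
(in particular each `x ↦ R(f(x,·))` belongs to `S(ℝ)`). -/
theorem reduction_lemma (R : SchwartzMap ℝ ℂ →L[ℂ] ℂ) :
    (∀ (f : SchwartzMap (ℝ × ℝ) ℂ) (x : ℝ),
      ∃ g : SchwartzMap ℝ ℂ, ∀ y : ℝ, g y = f (x, y)) ∧
    ∃ L : SchwartzMap (ℝ × ℝ) ℂ →L[ℂ] SchwartzMap ℝ ℂ,
      ∀ (f : SchwartzMap (ℝ × ℝ) ℂ) (x : ℝ) (g : SchwartzMap ℝ ℂ),
        (∀ y : ℝ, g y = f (x, y)) → (L f) x = R g := by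
  refine ⟨fun f x => ⟨RedLem.slice x f, fun y => rfl⟩, RedLem.L R, fun f x g hg => ?_⟩
  have : g = RedLem.slice x f := SchwartzMap.ext hg
  rw [this]
  rfl
end
end

section
/- The Gaussian f₀ reproduces itself under two-sided twisted multiplication: for every g ∈ S(ℝ²), (f₀ × g) × f₀ = ⟨f₀|g⟩ f₀. -/
noncomputable section

open MeasureTheory

/-- The twisted (Moyal) product of two functions on phase space `ℝ × ℝ`
(normalization ħ = 2), defined pointwise by the double integral. -/
def moyalI (f g : ℝ × ℝ → ℂ) (u : ℝ × ℝ) : ℂ :=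
  ((1 / (4 * Real.pi ^ 2) : ℝ) : ℂ) *
    ∫ v : ℝ × ℝ, ∫ w : ℝ × ℝ,
      f v * g w *
        Complex.exp (-Complex.I *
          (((v.1 - u.1) * (w.2 - u.2) - (v.2 - u.2) * (w.1 - u.1) : ℝ) : ℂ))

/-- The Gaussian `f₀(u) = 2 e^{-|u|²/2}` on phase space. -/
def f0 : ℝ × ℝ → ℂ :=
  fun u => (2 : ℂ) * Complex.exp (-(((u.1 ^ 2 + u.2 ^ 2) / 2 : ℝ) : ℂ))

theorem gauss2_integrable (b c d : ℂ) (hb : b.re < 0) :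
    Integrable (fun v : ℝ × ℝ =>
      Complex.exp (b * (v.1 : ℂ) ^ 2 + c * v.1 + 0) * Complex.exp (b * (v.2 : ℂ) ^ 2 + d * v.2 + 0)) :=
  (integrable_cexp_quadratic' hb c 0).mul_prod (integrable_cexp_quadratic' hb d 0)

theorem gauss2_integral (b c d : ℂ) (hb : b.re < 0) :
    ∫ v : ℝ × ℝ,
      Complex.exp (b * (v.1 : ℂ) ^ 2 + c * v.1 + 0) * Complex.exp (b * (v.2 : ℂ) ^ 2 + d * v.2 + 0)
      = (Real.pi / -b) * Complex.exp (-(c ^ 2 + d ^ 2) / (4 * b)) := by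
  have hb0 : b ≠ 0 := by rintro rfl; simp at hb
  have h0 : (Real.pi / -b : ℂ) ≠ 0 :=
    div_ne_zero (by exact_mod_cast Real.pi_ne_zero) (neg_ne_zero.mpr hb0)
  have := integral_prod_mul (μ := (volume : Measure ℝ)) (ν := (volume : Measure ℝ))
    (fun x : ℝ => Complex.exp (b * (x : ℂ) ^ 2 + c * x + 0))
    (fun x : ℝ => Complex.exp (b * (x : ℂ) ^ 2 + d * x + 0))
  rw [Measure.volume_eq_prod, this, integral_cexp_quadratic hb, integral_cexp_quadratic hb,
    mul_mul_mul_comm, ← Complex.cpow_add _ _ h0, ← Complex.exp_add]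
  congr 1
  · norm_num
  · congr 1; field_simp; ring

theorem f0_eq (v : ℝ × ℝ) : f0 v = 2 * Complex.exp (-(((v.1 : ℂ) ^ 2 + (v.2 : ℂ) ^ 2) / 2)) := by
  simp [f0]

theorem f0_integrable : Integrable f0 := by
  have h := (gauss2_integrable (-(1 / 2)) 0 0 (by norm_num)).const_mul 2
  refine h.congr (Filter.Eventually.of_forall fun v => ?_)
  simp only
  rw [f0_eq, ← Complex.exp_add]
  congr 2; ring

theorem f0_fourier (p q r : ℂ) :
    ∫ v : ℝ × ℝ, f0 v * Complex.exp (-Complex.I * (p * v.1 + q * v.2 + r)) =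
      4 * Real.pi * Complex.exp (-(p ^ 2 + q ^ 2) / 2 - Complex.I * r) := by
  have h : ∀ v : ℝ × ℝ, f0 v * Complex.exp (-Complex.I * (p * v.1 + q * v.2 + r)) =
      2 * Complex.exp (-Complex.I * r) *
      (Complex.exp (-(1 / 2) * (v.1 : ℂ) ^ 2 + (-Complex.I * p) * v.1 + 0) *
        Complex.exp (-(1 / 2) * (v.2 : ℂ) ^ 2 + (-Complex.I * q) * v.2 + 0)) := by
    intro v
    rw [f0_eq, mul_assoc, mul_assoc, ← Complex.exp_add, ← Complex.exp_add, ← Complex.exp_add]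
    congr 2; ring
  simp_rw [h]
  rw [integral_const_mul, gauss2_integral _ _ _ (by norm_num)]
  have : -((-Complex.I * p) ^ 2 + (-Complex.I * q) ^ 2) / (4 * -(1 / 2 : ℂ)) =
      -(p ^ 2 + q ^ 2) / 2 := by
    simp only [mul_pow, neg_sq, Complex.I_sq]; ring
  rw [this, sub_eq_add_neg, Complex.exp_add, neg_mul]
  field_simp
  ring

/-- the kernel of twisted multiplication by the Gaussian -/
def ker (v w : ℝ × ℝ) : ℂ :=
  Complex.exp (-(((w.1 : ℂ) - v.1) ^ 2 + ((w.2 : ℂ) - v.2) ^ 2) / 2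
    + Complex.I * (v.1 * w.2 - v.2 * w.1))

theorem moyal_right (h : ℝ × ℝ → ℂ) (u : ℝ × ℝ) :
    moyalI h f0 u = (1 / Real.pi : ℂ) * ∫ v : ℝ × ℝ, h v * ker v u := by
  have h1 : ∀ v : ℝ × ℝ, (∫ w : ℝ × ℝ, h v * f0 w *
        Complex.exp (-Complex.I *
          (((v.1 - u.1) * (w.2 - u.2) - (v.2 - u.2) * (w.1 - u.1) : ℝ) : ℂ))) =
      4 * Real.pi * (h v * ker v u) := by
    intro v
    have h2 := f0_fourier (-((v.2 : ℂ) - u.2)) ((v.1 : ℂ) - u.1)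
      (-((v.1 : ℂ) - u.1) * u.2 + ((v.2 : ℂ) - u.2) * u.1)
    simp_rw [mul_assoc (h v)]
    rw [integral_const_mul]
    trans h v * (4 * Real.pi * ker v u)
    · congr 1
      convert h2 using 1
      · congr 1; funext w; congr 2; push_cast; ring
      · rw [ker]; congr 2; ring
    · ring
  unfold moyalI
  simp_rw [h1]
  rw [integral_const_mul, ← mul_assoc]
  congr 1
  push_cast
  have : (Real.pi : ℂ) ≠ 0 := by exact_mod_cast Real.pi_ne_zero
  field_simp

theorem moyal_left (g : ℝ × ℝ → ℂ) (hg : Integrable g) (v : ℝ × ℝ) :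
    moyalI f0 g v = (1 / Real.pi : ℂ) * ∫ w : ℝ × ℝ, g w * ker v w := by
  have h1 : ∀ w : ℝ × ℝ, (∫ a : ℝ × ℝ, f0 a * g w *
        Complex.exp (-Complex.I *
          (((a.1 - v.1) * (w.2 - v.2) - (a.2 - v.2) * (w.1 - v.1) : ℝ) : ℂ))) =
      4 * Real.pi * (g w * ker v w) := by
    intro w
    have h2 := f0_fourier ((w.2 : ℂ) - v.2) (-((w.1 : ℂ) - v.1))
      (-(v.1 : ℂ) * ((w.2 : ℂ) - v.2) + (v.2 : ℂ) * ((w.1 : ℂ) - v.1))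
    simp_rw [mul_comm (f0 _) (g w), mul_assoc (g w)]
    rw [integral_const_mul]
    trans g w * (4 * Real.pi * ker v w)
    · congr 1
      convert h2 using 1
      · congr 1; funext w; congr 2; push_cast; ring
      · rw [ker]; congr 2; ring
    · ring
  unfold moyalI
  rw [integral_integral_swap]
  · simp_rw [h1]
    rw [integral_const_mul, ← mul_assoc]
    congr 1
    push_cast
    have : (Real.pi : ℂ) ≠ 0 := by exact_mod_cast Real.pi_ne_zero
    field_simp
  · have h3 := f0_integrable.mul_prod hg
    refine h3.mul_bdd (c := 1) ?_ ?_
    · apply Continuous.aestronglyMeasurable; fun_prop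
    · refine Filter.Eventually.of_forall fun z => le_of_eq ?_
      rw [Complex.norm_exp]; simp

theorem ker_norm (v w : ℝ × ℝ) :
    ‖ker v w‖ = Real.exp (-((w.1 - v.1) ^ 2 + (w.2 - v.2) ^ 2) / 2) := by
  have : ker v w = Complex.exp (((-((w.1 - v.1) ^ 2 + (w.2 - v.2) ^ 2) / 2 : ℝ) : ℂ)
      + ((v.1 * w.2 - v.2 * w.1 : ℝ) : ℂ) * Complex.I) := by
    rw [ker]; congr 1; push_cast; ring
  rw [this, Complex.norm_exp]
  simp only [Complex.add_re, Complex.re_ofReal_mul, Complex.I_re, Complex.ofReal_re]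
  simp

theorem ker_cont : Continuous (fun z : (ℝ × ℝ) × (ℝ × ℝ) => ker z.1 z.2) := by
  unfold ker; fun_prop

theorem ker_integrable (u : ℝ × ℝ) : Integrable (fun v => ker v u) := by
  have h := (f0_integrable.comp_sub_right u).norm
  refine h.mono' ?_ ?_
  · exact (ker_cont.comp (by fun_prop : Continuous fun v : ℝ × ℝ => (v, u))).aestronglyMeasurable
  · refine Filter.Eventually.of_forall fun v => ?_
    rw [ker_norm]
    simp only [f0, norm_mul, Complex.norm_exp, ← Complex.ofReal_neg, Complex.ofReal_re]
    have : -((u.1 - v.1) ^ 2 + (u.2 - v.2) ^ 2) / 2 =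
      -(((v - u).1 ^ 2 + (v - u).2 ^ 2) / 2) := by simp only [Prod.fst_sub, Prod.snd_sub]; ring
    rw [this]
    rw [Complex.norm_ofNat]
    have := Real.exp_pos (-(((v - u).1 ^ 2 + (v - u).2 ^ 2) / 2))
    linarith

theorem ker_comp (u w : ℝ × ℝ) :
    ∫ v : ℝ × ℝ, ker v w * ker v u = Real.pi / 4 * ((starRingEnd ℂ) (f0 w) * f0 u) := by
  have hf : (starRingEnd ℂ) (f0 w) = f0 w := by
    rw [f0, map_mul, ← Complex.exp_conj, map_neg, Complex.conj_ofReal, Complex.conj_ofNat]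
  have h : ∀ v : ℝ × ℝ, ker v w * ker v u =
      (1 / 4 * (f0 w * f0 u)) *
      (Complex.exp (-1 * (v.1 : ℂ) ^ 2 + ((w.1 + u.1) + Complex.I * (w.2 + u.2)) * v.1 + 0) *
        Complex.exp (-1 * (v.2 : ℂ) ^ 2 + ((w.2 + u.2) - Complex.I * (w.1 + u.1)) * v.2 + 0)) := by
    intro v
    rw [f0_eq, f0_eq, ker, ker]
    rw [show ∀ a b c : ℂ, 1 / 4 * (2 * a * (2 * b)) * c = a * b * c by intros; ring]
    simp only [← Complex.exp_add]
    congr 1; ring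
  simp_rw [h]
  rw [integral_const_mul, gauss2_integral _ _ _ (by norm_num), hf]
  have : ((w.1 + u.1 : ℂ) + Complex.I * (w.2 + u.2)) ^ 2 +
      ((w.2 + u.2 : ℂ) - Complex.I * (w.1 + u.1)) ^ 2 = 0 := by
    ring_nf; simp only [Complex.I_sq]; ring
  rw [this]
  simp
  ring

/-- the Gaussian `f₀` reproduces itself under two-sided twisted
multiplication: `(f₀ × g) × f₀ = ⟨f₀|g⟩ f₀` for every Schwartz `g`, where
`⟨f₀|g⟩ = (4π)⁻¹ ∫ conj(f₀) g`. -/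
theorem gaussian_reproducing (g : SchwartzMap (ℝ × ℝ) ℂ) :
    moyalI (moyalI f0 (⇑g)) f0 =
      fun u : ℝ × ℝ =>
        (((4 * Real.pi)⁻¹ : ℝ) : ℂ) *
          (∫ v : ℝ × ℝ, (starRingEnd ℂ) (f0 v) * g v) * f0 u := by
  funext u
  have hg : Integrable (⇑g) := g.integrable
  rw [moyal_right]
  simp_rw [moyal_left _ hg]
  have h1 : ∀ v : ℝ × ℝ, (1 / Real.pi : ℂ) * (∫ w : ℝ × ℝ, g w * ker v w) * ker v u =
      (1 / Real.pi : ℂ) * ∫ w : ℝ × ℝ, g w * (ker v w * ker v u) := by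
    intro v
    rw [mul_assoc, ← integral_mul_const]
    simp_rw [mul_assoc]
  simp_rw [h1]
  rw [integral_const_mul, integral_integral_swap]
  · simp_rw [integral_const_mul, ker_comp]
    have h2 : ∀ w : ℝ × ℝ, g w * (Real.pi / 4 * ((starRingEnd ℂ) (f0 w) * f0 u)) =
      (Real.pi / 4 * f0 u) * ((starRingEnd ℂ) (f0 w) * g w) := by intro w; ring
    simp_rw [h2]
    rw [integral_const_mul]
    have : (Real.pi : ℂ) ≠ 0 := by exact_mod_cast Real.pi_ne_zero
    push_cast
    field_simp
  · have h3 := (ker_integrable u).mul_prod hg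
    have h4 := h3.mul_bdd (c := 1) ker_cont.aestronglyMeasurable (by
      refine Filter.Eventually.of_forall fun z => ?_
      rw [ker_norm, Real.exp_le_one_iff]
      have := sq_nonneg (z.2.1 - z.1.1)
      have := sq_nonneg (z.2.2 - z.1.2)
      linarith)
    refine h4.congr (Filter.Eventually.of_forall fun z => ?_)
    simp only [Function.uncurry]
    ring
end
end

section
/- Positivity of the vacuum functional: for every g ∈ S(ℝ²), ⟨f₀ | (g* × g) × f₀⟩ = (4π)^{−1} ∫_{ℝ²} |(g × f₀)(u)|² du; in particular ω(g* × g) ≥ 0, where ω(h) := ⟨f₀ | h × f₀⟩ and g* denotes the pointwise complex conjugate of g. -/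
noncomputable section

open MeasureTheory

/-- The vacuum functional `ω(h) = ⟨f₀ | h × f₀⟩ = (4π)⁻¹ ∫ conj(f₀) (h × f₀)`. -/
def omegaF (h : ℝ × ℝ → ℂ) : ℂ :=
  (((4 * Real.pi)⁻¹ : ℝ) : ℂ) *
    ∫ u : ℝ × ℝ, (starRingEnd ℂ) (f0 u) * moyalI h f0 u


/-- Gaussian weight. -/
def gsA (u : ℝ × ℝ) : ℂ := Complex.exp (-(((u.1 ^ 2 + u.2 ^ 2) / 2 : ℝ) : ℂ))

/-- Symplectic phase. -/
def phA (a u : ℝ × ℝ) : ℂ := Complex.exp (Complex.I * ((a.1 * u.2 - a.2 * u.1 : ℝ) : ℂ))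

/-- The kernel obtained after integrating out everything else. -/
def kerA (g : ℝ × ℝ → ℂ) (p : (ℝ × ℝ) × (ℝ × ℝ)) : ℂ :=
  ((starRingEnd ℂ) (g p.1) * g p.2) * phA p.2 p.1 * Complex.exp (-((((p.1.1 - p.2.1) ^ 2 + (p.1.2 - p.2.2) ^ 2) / 2 : ℝ) : ℂ))

lemma gauss2_aux (b : ℝ) (hb : 0 < b) (c1 c2 d : ℂ) :
    Integrable (fun u : ℝ × ℝ => Complex.exp (-(b : ℂ) * (u.1 ^ 2 + u.2 ^ 2) + c1 * u.1 + c2 * u.2 + d)) ∧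
    ∫ u : ℝ × ℝ, Complex.exp (-(b : ℂ) * (u.1 ^ 2 + u.2 ^ 2) + c1 * u.1 + c2 * u.2 + d) =
      (Real.pi / b : ℂ) * Complex.exp (d + (c1 ^ 2 + c2 ^ 2) / (4 * b)) := by
  have hb' : 0 < (b : ℂ).re := by simpa using hb
  have hbn : (-(b : ℂ)).re < 0 := by simpa using hb
  have hb0 : (b : ℂ) ≠ 0 := by exact_mod_cast hb.ne'
  have e : (fun u : ℝ × ℝ => Complex.exp (-(b : ℂ) * (u.1 ^ 2 + u.2 ^ 2) + c1 * u.1 + c2 * u.2 + d)) =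
      fun u : ℝ × ℝ => Complex.exp (-(b : ℂ) * u.1 ^ 2 + c1 * u.1 + d) *
        Complex.exp (-(b : ℂ) * u.2 ^ 2 + c2 * u.2 + 0) := by
    ext u
    rw [← Complex.exp_add]
    ring_nf
  rw [e]
  constructor
  · exact (integrable_cexp_quadratic hb' c1 d).mul_prod (integrable_cexp_quadratic hb' c2 0)
  · rw [Measure.volume_eq_prod, integral_prod_mul (fun x : ℝ => Complex.exp (-(b : ℂ) * x ^ 2 + c1 * x + d))
      (fun x : ℝ => Complex.exp (-(b : ℂ) * x ^ 2 + c2 * x + 0)),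
      integral_cexp_quadratic hbn, integral_cexp_quadratic hbn, neg_neg]
    have h1 : ((Real.pi : ℂ) / b) ^ (1 / 2 : ℂ) * ((Real.pi : ℂ) / b) ^ (1 / 2 : ℂ) = Real.pi / b := by
      rw [← Complex.cpow_add _ _ (by
        have : (Real.pi : ℂ) ≠ 0 := by exact_mod_cast Real.pi_ne_zero
        exact div_ne_zero this hb0)]
      norm_num
    calc _ = (((Real.pi : ℂ) / b) ^ (1 / 2 : ℂ) * ((Real.pi : ℂ) / b) ^ (1 / 2 : ℂ)) *
        (Complex.exp (d - c1 ^ 2 / (4 * -(b : ℂ))) * Complex.exp (0 - c2 ^ 2 / (4 * -(b : ℂ)))) := by ring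
      _ = _ := by
        rw [h1, ← Complex.exp_add]
        congr 2
        field_simp
        ring

lemma gsA_continuous : Continuous gsA := by unfold gsA; fun_prop

lemma phA_continuous : Continuous (fun p : (ℝ × ℝ) × (ℝ × ℝ) => phA p.1 p.2) := by
  unfold phA; fun_prop

lemma phA_norm (a u : ℝ × ℝ) : ‖phA a u‖ = 1 := by
  unfold phA
  rw [mul_comm, Complex.norm_exp_ofReal_mul_I]

lemma gsA_norm_le (u : ℝ × ℝ) : ‖gsA u‖ ≤ 1 := by
  unfold gsA
  rw [← Complex.ofReal_neg, Complex.norm_exp_ofReal]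
  apply Real.exp_le_one_iff.2
  nlinarith [sq_nonneg u.1, sq_nonneg u.2]

lemma gsA_integrable : Integrable gsA := by
  refine (gauss2_aux (1 / 2) (by norm_num) 0 0 0).1.congr (Filter.Eventually.of_forall fun u => ?_)
  simp only [gsA]
  congr 1
  push_cast
  ring

lemma gsA_conj (u : ℝ × ℝ) : (starRingEnd ℂ) (gsA u) = gsA u := by
  unfold gsA
  rw [← Complex.exp_conj, ← Complex.ofReal_neg, Complex.conj_ofReal]

lemma phA_conj (a u : ℝ × ℝ) : (starRingEnd ℂ) (phA a u) = phA u a := by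
  unfold phA
  rw [← Complex.exp_conj, map_mul, Complex.conj_ofReal, Complex.conj_I]
  congr 1
  push_cast
  ring

lemma moyal_f0 (h : ℝ × ℝ → ℂ) (u : ℝ × ℝ) :
    moyalI h f0 u = (1 / Real.pi : ℂ) * ∫ v : ℝ × ℝ, h v * (gsA (u - v) * phA v u) := by
  unfold moyalI
  have key : ∀ v : ℝ × ℝ, (∫ w : ℝ × ℝ, h v * f0 w *
        Complex.exp (-Complex.I *
          (((v.1 - u.1) * (w.2 - u.2) - (v.2 - u.2) * (w.1 - u.1) : ℝ) : ℂ)))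
      = (4 * Real.pi : ℂ) * (h v * (gsA (u - v) * phA v u)) := by
    intro v
    have e : ∀ w : ℝ × ℝ, h v * f0 w *
        Complex.exp (-Complex.I *
          (((v.1 - u.1) * (w.2 - u.2) - (v.2 - u.2) * (w.1 - u.1) : ℝ) : ℂ)) =
        (2 * h v) * Complex.exp (-((1 / 2 : ℝ) : ℂ) * (w.1 ^ 2 + w.2 ^ 2) +
          (Complex.I * (v.2 - u.2)) * w.1 + (-Complex.I * (v.1 - u.1)) * w.2 +
          Complex.I * (v.1 * u.2 - v.2 * u.1)) := by
      intro w
      unfold f0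
      rw [show ∀ a b : ℂ, h v * (2 * Complex.exp a) * b = (2 * h v) * (Complex.exp a * b) by
        intros; ring, ← Complex.exp_add]
      congr 2
      push_cast
      ring
    simp_rw [e]
    rw [integral_const_mul, (gauss2_aux (1 / 2) (by norm_num) _ _ _).2]
    unfold gsA phA
    rw [← Complex.exp_add]
    rw [show ∀ X : ℂ, 2 * h v * ((Real.pi : ℂ) / ((1 / 2 : ℝ) : ℂ) * X) = 4 * Real.pi * (h v * X) by
      intro X; push_cast; ring]
    congr 3
    push_cast
    simp only [mul_pow, neg_sq, Complex.I_sq, Prod.fst_sub, Prod.snd_sub]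
    push_cast
    ring
  simp_rw [key]
  rw [integral_const_mul, ← mul_assoc]
  congr 1
  have : (Real.pi : ℂ) ≠ 0 := by exact_mod_cast Real.pi_ne_zero
  push_cast
  field_simp

lemma omega_bdd (h : ℝ × ℝ → ℂ) (hm : AEStronglyMeasurable h) (C : ℝ) (hC : ∀ v, ‖h v‖ ≤ C) :
    ∫ u : ℝ × ℝ, (starRingEnd ℂ) (f0 u) * moyalI h f0 u = 2 * ∫ v : ℝ × ℝ, h v * gsA v := by
  have hpi : (Real.pi : ℂ) ≠ 0 := by exact_mod_cast Real.pi_ne_zero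
  have e1 : ∀ u, (starRingEnd ℂ) (f0 u) = 2 * gsA u := by
    intro u
    have : f0 u = 2 * gsA u := rfl
    rw [this, map_mul, gsA_conj, map_ofNat]
  have e2 : ∀ u, (starRingEnd ℂ) (f0 u) * moyalI h f0 u =
      (2 / Real.pi : ℂ) * ∫ v : ℝ × ℝ, (h v * phA v u) * (gsA (u - v) * gsA u) := by
    intro u
    rw [e1, moyal_f0]
    rw [show ∀ X : ℂ, 2 * gsA u * (1 / Real.pi * X) = 2 / Real.pi * (gsA u * X) by intros; ring]
    rw [← integral_const_mul]
    congr 2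
    ext v
    ring
  simp_rw [e2]
  rw [integral_const_mul, integral_integral_swap]
  · have e3 : ∀ v : ℝ × ℝ, ∫ u : ℝ × ℝ, (h v * phA v u) * (gsA (u - v) * gsA u) =
        Real.pi * (h v * gsA v) := by
      intro v
      have e : ∀ u : ℝ × ℝ, (h v * phA v u) * (gsA (u - v) * gsA u) =
          h v * Complex.exp (-((1 : ℝ) : ℂ) * (u.1 ^ 2 + u.2 ^ 2) +
            (v.1 - Complex.I * v.2) * u.1 + (v.2 + Complex.I * v.1) * u.2 +
            (-(v.1 ^ 2 + v.2 ^ 2) / 2)) := by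
        intro u
        unfold gsA phA
        rw [mul_assoc, ← Complex.exp_add, ← Complex.exp_add]
        congr 2
        simp only [Prod.fst_sub, Prod.snd_sub]
        push_cast
        ring
      simp_rw [e]
      rw [integral_const_mul, (gauss2_aux 1 (by norm_num) _ _ _).2]
      unfold gsA
      rw [show ∀ X : ℂ, h v * ((Real.pi : ℂ) / ((1 : ℝ) : ℂ) * X) = Real.pi * (h v * X) by
        intro X; push_cast; ring]
      congr 3
      have hI := Complex.I_sq
      push_cast
      linear_combination ((v.1 ^ 2 + v.2 ^ 2) / 4 : ℂ) * hI
    simp_rw [e3]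
    rw [integral_const_mul, ← mul_assoc]
    congr 1
    field_simp
  · have hg := (gsA_integrable.convolution_integrand (ContinuousLinearMap.mul ℂ ℂ) gsA_integrable).swap
    have hg' : Integrable (fun p : (ℝ × ℝ) × (ℝ × ℝ) => gsA (p.1 - p.2) * gsA p.1)
        (volume.prod volume) := by
      have h1 : Integrable (fun p : (ℝ × ℝ) × (ℝ × ℝ) => gsA p.1 * gsA (p.2 - p.1))
        (volume.prod volume) := hg
      refine h1.congr (Filter.Eventually.of_forall fun p => ?_)
      have : gsA (p.2 - p.1) = gsA (p.1 - p.2) := by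
        unfold gsA
        congr 3
        simp only [Prod.fst_sub, Prod.snd_sub]
        ring
      simp only [this]
      ring
    refine hg'.bdd_mul (c := C) (f := fun p : (ℝ × ℝ) × (ℝ × ℝ) => h p.2 * phA p.2 p.1) ?_ ?_
    · exact hm.comp_snd.mul (phA_continuous.comp continuous_swap).aestronglyMeasurable
    · refine Filter.Eventually.of_forall fun p => ?_
      rw [norm_mul, phA_norm, mul_one]
      exact hC _

section
variable (g : SchwartzMap (ℝ × ℝ) ℂ)

lemma gg_integrable : Integrable (fun p : (ℝ × ℝ) × (ℝ × ℝ) => (starRingEnd ℂ) (g p.1) * g p.2) :=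
  Integrable.mul_prod (f := fun v => (starRingEnd ℂ) (g v))
    (Complex.conjLIE.integrable_comp_iff.2 g.integrable) g.integrable

lemma moyal_gg (u : ℝ × ℝ) : moyalI (fun u => (starRingEnd ℂ) (g u)) (⇑g) u =
    (1 / (4 * Real.pi ^ 2) : ℂ) * ∫ p : (ℝ × ℝ) × (ℝ × ℝ),
      (phA p.2 p.1 * phA p.1 u * phA u p.2) * ((starRingEnd ℂ) (g p.1) * g p.2) := by
  unfold moyalI
  rw [Measure.volume_eq_prod (ℝ × ℝ) (ℝ × ℝ), integral_prod]
  · push_cast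
    congr 3
    ext v
    congr 1
    ext w
    unfold phA
    rw [← Complex.exp_add, ← Complex.exp_add, mul_comm]
    congr 2
    push_cast
    ring
  · refine (gg_integrable g).bdd_mul (c := 1) ?_ ?_
    · refine Continuous.aestronglyMeasurable ?_
      unfold phA; fun_prop
    · refine Filter.Eventually.of_forall fun p => ?_
      simp [phA_norm]

lemma moyal_gg_bdd (u : ℝ × ℝ) : ‖moyalI (fun u => (starRingEnd ℂ) (g u)) (⇑g) u‖ ≤
    ‖(1 / (4 * Real.pi ^ 2) : ℂ)‖ * ∫ p : (ℝ × ℝ) × (ℝ × ℝ), ‖(starRingEnd ℂ) (g p.1) * g p.2‖ := by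
  rw [moyal_gg, norm_mul]
  gcongr
  refine (norm_integral_le_integral_norm _).trans (le_of_eq ?_)
  congr 1
  ext p
  rw [norm_mul]
  simp [phA_norm]

lemma moyal_gg_meas : AEStronglyMeasurable (moyalI (fun u => (starRingEnd ℂ) (g u)) (⇑g)) := by
  have : moyalI (fun u => (starRingEnd ℂ) (g u)) (⇑g) = fun u =>
    (1 / (4 * Real.pi ^ 2) : ℂ) * ∫ p : (ℝ × ℝ) × (ℝ × ℝ),
      (phA p.2 p.1 * phA p.1 u * phA u p.2) * ((starRingEnd ℂ) (g p.1) * g p.2) := by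
    ext u; exact moyal_gg g u
  rw [this]
  refine (StronglyMeasurable.const_mul ?_ _).aestronglyMeasurable
  refine StronglyMeasurable.integral_prod_right (ν := volume) (f := fun (u : ℝ × ℝ) (p : (ℝ × ℝ) × (ℝ × ℝ)) =>
    (phA p.2 p.1 * phA p.1 u * phA u p.2) * ((starRingEnd ℂ) (g p.1) * g p.2)) ?_
  refine Continuous.stronglyMeasurable ?_
  have := g.continuous
  unfold phA Function.uncurry
  fun_prop

lemma lhs_eq : ∫ u, moyalI (fun u => (starRingEnd ℂ) (g u)) (⇑g) u * gsA u =
    (1 / (2 * Real.pi) : ℂ) * ∫ p, kerA g p := by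
  have hpi : (Real.pi : ℂ) ≠ 0 := by exact_mod_cast Real.pi_ne_zero
  have e2 : ∀ u, moyalI (fun u => (starRingEnd ℂ) (g u)) (⇑g) u * gsA u =
      (1 / (4 * Real.pi ^ 2) : ℂ) * ∫ p : (ℝ × ℝ) × (ℝ × ℝ),
      (phA p.2 p.1 * phA p.1 u * phA u p.2) * (gsA u * ((starRingEnd ℂ) (g p.1) * g p.2)) := by
    intro u
    rw [moyal_gg, mul_assoc, ← integral_mul_const]
    congr 2
    ext v
    ring
  simp_rw [e2]
  rw [integral_const_mul, integral_integral_swap]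
  · have e3 : ∀ p : (ℝ × ℝ) × (ℝ × ℝ), ∫ u : ℝ × ℝ,
        (phA p.2 p.1 * phA p.1 u * phA u p.2) * (gsA u * ((starRingEnd ℂ) (g p.1) * g p.2)) =
        (2 * Real.pi) * kerA g p := by
      intro p
      have e : ∀ u : ℝ × ℝ,
          (phA p.2 p.1 * phA p.1 u * phA u p.2) * (gsA u * ((starRingEnd ℂ) (g p.1) * g p.2)) =
          ((starRingEnd ℂ) (g p.1) * g p.2 * phA p.2 p.1) *
            Complex.exp (-((1 / 2 : ℝ) : ℂ) * (u.1 ^ 2 + u.2 ^ 2) +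
            (Complex.I * (p.2.2 - p.1.2)) * u.1 + (Complex.I * (p.1.1 - p.2.1)) * u.2 + 0) := by
        intro u
        have : Complex.exp (-((1 / 2 : ℝ) : ℂ) * (u.1 ^ 2 + u.2 ^ 2) +
            (Complex.I * (p.2.2 - p.1.2)) * u.1 + (Complex.I * (p.1.1 - p.2.1)) * u.2 + 0) =
            phA p.1 u * phA u p.2 * gsA u := by
          unfold gsA phA
          rw [← Complex.exp_add, ← Complex.exp_add]
          congr 1
          push_cast
          ring
        rw [this]
        ring
      simp_rw [e]
      rw [integral_const_mul, (gauss2_aux (1 / 2) (by norm_num) _ _ _).2]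
      unfold kerA
      rw [show ∀ X Y : ℂ, Y * ((Real.pi : ℂ) / ((1 / 2 : ℝ) : ℂ) * X) = 2 * Real.pi * (Y * X) by
        intro X Y; push_cast; ring]
      congr 3
      simp only [mul_pow, Complex.I_sq]
      push_cast
      ring
    simp_rw [e3]
    rw [integral_const_mul, ← mul_assoc]
    congr 1
    field_simp
    norm_num
  · have hg' := gsA_integrable.mul_prod (gg_integrable g)
    refine hg'.bdd_mul (c := 1) (f := fun q : (ℝ × ℝ) × ((ℝ × ℝ) × (ℝ × ℝ)) =>
      phA q.2.2 q.2.1 * phA q.2.1 q.1 * phA q.1 q.2.2) ?_ ?_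
    · refine Continuous.aestronglyMeasurable ?_
      unfold phA; fun_prop
    · refine Filter.Eventually.of_forall fun p => ?_
      simp [phA_norm]

lemma rhs_eq : ∫ u, ((‖moyalI (⇑g) f0 u‖ ^ 2 : ℝ) : ℂ) = (1 / Real.pi : ℂ) * ∫ p, kerA g p := by
  have hpi : (Real.pi : ℂ) ≠ 0 := by exact_mod_cast Real.pi_ne_zero
  have e2 : ∀ u, ((‖moyalI (⇑g) f0 u‖ ^ 2 : ℝ) : ℂ) =
      (1 / Real.pi ^ 2 : ℂ) * ∫ p : (ℝ × ℝ) × (ℝ × ℝ),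
      (phA u p.1 * phA p.2 u * gsA (u - p.2)) *
        (gsA (u - p.1) * (starRingEnd ℂ) (g p.1) * g p.2) := by
    intro u
    rw [Complex.ofReal_pow, ← Complex.conj_mul', moyal_f0, map_mul, ← integral_conj]
    rw [show ∀ X Y Z : ℂ, Z * X * (1 / Real.pi * Y) = (Z * (1 / Real.pi)) * (X * Y) by intros; ring]
    rw [Measure.volume_eq_prod (ℝ × ℝ) (ℝ × ℝ), ← integral_prod_mul]
    congr 1
    · rw [map_div₀, Complex.conj_ofReal, map_one]
      ring
    · congr 1
      ext p
      simp only [map_mul, gsA_conj, phA_conj]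
      ring
  simp_rw [e2]
  rw [integral_const_mul, integral_integral_swap]
  · have e3 : ∀ p : (ℝ × ℝ) × (ℝ × ℝ), ∫ u : ℝ × ℝ,
        (phA u p.1 * phA p.2 u * gsA (u - p.2)) *
        (gsA (u - p.1) * (starRingEnd ℂ) (g p.1) * g p.2) =
        Real.pi * kerA g p := by
      intro p
      have e : ∀ u : ℝ × ℝ,
          (phA u p.1 * phA p.2 u * gsA (u - p.2)) *
          (gsA (u - p.1) * (starRingEnd ℂ) (g p.1) * g p.2) =
          ((starRingEnd ℂ) (g p.1) * g p.2) *
            Complex.exp (-((1 : ℝ) : ℂ) * (u.1 ^ 2 + u.2 ^ 2) +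
            (p.1.1 + p.2.1 + Complex.I * (p.1.2 - p.2.2)) * u.1 +
            (p.1.2 + p.2.2 + Complex.I * (p.2.1 - p.1.1)) * u.2 +
            (-(p.1.1 ^ 2 + p.1.2 ^ 2 + p.2.1 ^ 2 + p.2.2 ^ 2) / 2)) := by
        intro u
        have : Complex.exp (-((1 : ℝ) : ℂ) * (u.1 ^ 2 + u.2 ^ 2) +
            (p.1.1 + p.2.1 + Complex.I * (p.1.2 - p.2.2)) * u.1 +
            (p.1.2 + p.2.2 + Complex.I * (p.2.1 - p.1.1)) * u.2 +
            (-(p.1.1 ^ 2 + p.1.2 ^ 2 + p.2.1 ^ 2 + p.2.2 ^ 2) / 2)) =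
            phA u p.1 * phA p.2 u * gsA (u - p.2) * gsA (u - p.1) := by
          unfold gsA phA
          rw [← Complex.exp_add, ← Complex.exp_add, ← Complex.exp_add]
          congr 1
          simp only [Prod.fst_sub, Prod.snd_sub]
          push_cast
          ring
        rw [this]
        ring
      simp_rw [e]
      rw [integral_const_mul, (gauss2_aux 1 (by norm_num) _ _ _).2]
      unfold kerA phA
      rw [show ∀ X Y : ℂ, Y * ((Real.pi : ℂ) / ((1 : ℝ) : ℂ) * X) = Real.pi * (Y * X) by
        intro X Y; push_cast; ring]
      rw [mul_assoc ((starRingEnd ℂ) (g p.1) * g p.2), ← Complex.exp_add]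
      congr 3
      have hI := Complex.I_sq
      push_cast
      linear_combination (((p.1.1 - p.2.1) ^ 2 + (p.1.2 - p.2.2) ^ 2) / 4 : ℂ) * hI
    simp_rw [e3]
    rw [integral_const_mul, ← mul_assoc]
    congr 1
    field_simp
  · have hc : Integrable (fun v => (starRingEnd ℂ) (g v)) :=
      Complex.conjLIE.integrable_comp_iff.2 g.integrable
    have h1 := (hc.convolution_integrand (ContinuousLinearMap.mul ℂ ℂ) gsA_integrable).mul_prod
      (g.integrable (μ := volume))
    have h2 : Integrable (fun q : (ℝ × ℝ) × ((ℝ × ℝ) × (ℝ × ℝ)) =>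
        gsA (q.1 - q.2.1) * (starRingEnd ℂ) (g q.2.1) * g q.2.2) (volume.prod volume) := by
      refine ((volume_preserving_prodAssoc (α₁ := ℝ × ℝ) (β₁ := ℝ × ℝ)
        (γ₁ := ℝ × ℝ)).integrable_comp_emb MeasurableEquiv.prodAssoc.measurableEmbedding).1 ?_
      refine h1.congr (Filter.Eventually.of_forall fun q => ?_)
      simp [MeasurableEquiv.prodAssoc, mul_comm]
    refine h2.bdd_mul (c := 1) (f := fun q : (ℝ × ℝ) × ((ℝ × ℝ) × (ℝ × ℝ)) =>
      phA q.1 q.2.1 * phA q.2.2 q.1 * gsA (q.1 - q.2.2)) ?_ ?_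
    · refine Continuous.aestronglyMeasurable ?_
      unfold phA gsA; fun_prop
    · refine Filter.Eventually.of_forall fun p => ?_
      simp only [norm_mul, phA_norm, one_mul]
      exact gsA_norm_le _

end

/-- positivity of the vacuum functional: for every `g ∈ S(ℝ²)`,
`⟨f₀ | (g* × g) × f₀⟩ = (4π)⁻¹ ∫ |(g × f₀)(u)|² du`; in particular
`ω(g* × g) ≥ 0` (it is real and nonnegative). -/
theorem vacuum_functional_positive (g : SchwartzMap (ℝ × ℝ) ℂ) :
    omegaF (moyalI (fun u => (starRingEnd ℂ) (g u)) (⇑g)) =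
        ((((4 * Real.pi)⁻¹ : ℝ) * ∫ u : ℝ × ℝ, ‖moyalI (⇑g) f0 u‖ ^ 2 : ℝ) : ℂ) ∧
      0 ≤ (omegaF (moyalI (fun u => (starRingEnd ℂ) (g u)) (⇑g))).re ∧
      (omegaF (moyalI (fun u => (starRingEnd ℂ) (g u)) (⇑g))).im = 0 := by
  have hmain : omegaF (moyalI (fun u => (starRingEnd ℂ) (g u)) (⇑g)) =
        ((((4 * Real.pi)⁻¹ : ℝ) * ∫ u : ℝ × ℝ, ‖moyalI (⇑g) f0 u‖ ^ 2 : ℝ) : ℂ) := by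
    unfold omegaF
    rw [omega_bdd _ (moyal_gg_meas g) _ (moyal_gg_bdd g), lhs_eq, Complex.ofReal_mul,
      ← integral_complex_ofReal, rhs_eq, ← mul_assoc 2]
    congr 2
    have hpi : (Real.pi : ℂ) ≠ 0 := by exact_mod_cast Real.pi_ne_zero
    field_simp
  refine ⟨hmain, ?_, ?_⟩
  · rw [hmain, Complex.ofReal_re]
    have := Real.pi_pos
    have h2 : 0 ≤ ∫ u : ℝ × ℝ, ‖moyalI (⇑g) f0 u‖ ^ 2 := integral_nonneg fun u => by positivity
    positivity
  · rw [hmain, Complex.ofReal_im]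
end
end

section
/- Factorization lemma for weighted square-summable matrices: let r > 1 be real and let c : ℕ×ℕ → ℂ satisfy Σ := ∑_{m,n} (2m+1)^r |c_{mn}|² < ∞. Then there exist d : ℕ → ℝ with d_m ≥ 0 and b : ℕ×ℕ → ℂ such that c_{mn} = d_m b_{mn} for all m, n, ∑_m d_m² = Σ, and ∑_{m,n} |b_{mn}|² ≤ (1 − 2^{−r}) ζ(r). -/
noncomputable section

/-- The Riemann zeta value `ζ(r) = ∑_{k=1}^∞ k^{-r}` for real `r`. -/
def zetaR (r : ℝ) : ℝ := ∑' k : ℕ, ((k : ℝ) + 1) ^ (-r)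

theorem zeta_summable_aux (r : ℝ) (hr : 1 < r) :
    Summable (fun k : ℕ => ((k : ℝ) + 1) ^ (-r)) := by
  have h := (summable_nat_add_iff 1).2 (Real.summable_nat_rpow.2 (show -r < -1 by linarith))
  simpa using h

theorem odd_sum_aux (r : ℝ) (hr : 1 < r) :
    HasSum (fun m : ℕ => (2 * (m : ℝ) + 1) ^ (-r)) ((1 - 2 ^ (-r)) * zetaR r) := by
  have hs := zeta_summable_aux r hr
  have h0 : Summable (fun m : ℕ => (2 * (m : ℝ) + 1) ^ (-r)) := by
    have := hs.comp_injective (i := fun k : ℕ => 2 * k) (fun a b h => by simpa using h)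
    refine this.congr fun m => ?_
    simp
  have h1 : ∀ m : ℕ, (((2 * m + 1 : ℕ) : ℝ) + 1) ^ (-r) = 2 ^ (-r) * ((m : ℝ) + 1) ^ (-r) := by
    intro m
    rw [← Real.mul_rpow (by norm_num) (by positivity)]
    congr 1
    push_cast
    ring
  have h2 : Summable (fun m : ℕ => (((2 * m + 1 : ℕ) : ℝ) + 1) ^ (-r)) := by
    simp_rw [h1]
    exact hs.mul_left _
  have key := tsum_even_add_odd (f := fun k : ℕ => ((k : ℝ) + 1) ^ (-r)) (by simpa using h0) h2
  simp_rw [h1, tsum_mul_left] at key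
  push_cast at key
  have : (∑' m : ℕ, (2 * (m : ℝ) + 1) ^ (-r)) = (1 - 2 ^ (-r)) * zetaR r := by
    unfold zetaR
    linarith
  rw [← this]
  exact h0.hasSum

/-- factorization lemma for weighted square-summable matrices:
if `r > 1` and `∑_{m,n} (2m+1)^r |c_{mn}|² = Σ < ∞`, then there are `d : ℕ → ℝ`
with `d_m ≥ 0` and `b : ℕ×ℕ → ℂ` with `c_{mn} = d_m b_{mn}`,
`∑_m d_m² = Σ`, and `∑_{m,n} |b_{mn}|² ≤ (1 − 2^{−r}) ζ(r)`. -/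
theorem weighted_matrix_factorization
    (r : ℝ) (hr : 1 < r) (c : ℕ × ℕ → ℂ)
    (hc : Summable fun mn : ℕ × ℕ => (2 * (mn.1 : ℝ) + 1) ^ r * ‖c mn‖ ^ 2) :
    ∃ (d : ℕ → ℝ) (b : ℕ × ℕ → ℂ),
      (∀ m, 0 ≤ d m) ∧
      (∀ m n : ℕ, c (m, n) = (d m : ℂ) * b (m, n)) ∧
      Summable (fun m : ℕ => d m ^ 2) ∧
      (∑' m : ℕ, d m ^ 2) =
        ∑' mn : ℕ × ℕ, (2 * (mn.1 : ℝ) + 1) ^ r * ‖c mn‖ ^ 2 ∧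
      Summable (fun mn : ℕ × ℕ => ‖b mn‖ ^ 2) ∧
      (∑' mn : ℕ × ℕ, ‖b mn‖ ^ 2) ≤ (1 - 2 ^ (-r)) * zetaR r := by
  have hw0 : ∀ mn : ℕ × ℕ, 0 ≤ (2 * (mn.1 : ℝ) + 1) ^ r * ‖c mn‖ ^ 2 := fun mn => by positivity
  obtain ⟨hrow, hW⟩ := (summable_prod_of_nonneg hw0).1 hc
  set W : ℕ → ℝ := fun m => ∑' n : ℕ, (2 * (m : ℝ) + 1) ^ r * ‖c (m, n)‖ ^ 2 with hWdef
  have hW0 : ∀ m, 0 ≤ W m := fun m => tsum_nonneg fun n => hw0 (m, n)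
  have hsq : ∀ m, Real.sqrt (W m) ^ 2 = W m := fun m => Real.sq_sqrt (hW0 m)
  have hb : ∀ m n : ℕ, ‖c (m, n) / ((Real.sqrt (W m) : ℝ) : ℂ)‖ ^ 2 =
      (2 * (m : ℝ) + 1) ^ (-r) / W m * ((2 * (m : ℝ) + 1) ^ r * ‖c (m, n)‖ ^ 2) := by
    intro m n
    have hp : (2 * (m : ℝ) + 1) ^ (-r) * (2 * (m : ℝ) + 1) ^ r = 1 := by
      rw [← Real.rpow_add (by positivity)]
      simp
    rw [norm_div, div_pow, Complex.norm_real, Real.norm_eq_abs, sq_abs, hsq]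
    linear_combination (-(‖c (m, n)‖ ^ 2 / W m)) * hp
  have hbrow : ∀ m, Summable fun n : ℕ => ‖c (m, n) / ((Real.sqrt (W m) : ℝ) : ℂ)‖ ^ 2 := by
    intro m
    simp_rw [hb]
    exact (hrow m).mul_left _
  have hbsum : ∀ m, (∑' n : ℕ, ‖c (m, n) / ((Real.sqrt (W m) : ℝ) : ℂ)‖ ^ 2) ≤
      (2 * (m : ℝ) + 1) ^ (-r) := by
    intro m
    simp_rw [hb]
    rw [tsum_mul_left]
    change _ / W m * W m ≤ _
    by_cases h : W m = 0
    · rw [h, mul_zero]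
      positivity
    · rw [div_mul_cancel₀ _ h]
  have hodd := odd_sum_aux r hr
  have hbW : Summable fun m : ℕ => ∑' n : ℕ, ‖c (m, n) / ((Real.sqrt (W m) : ℝ) : ℂ)‖ ^ 2 :=
    Summable.of_nonneg_of_le (fun m => tsum_nonneg fun n => by positivity) hbsum hodd.summable
  have hB : Summable fun mn : ℕ × ℕ => ‖c mn / ((Real.sqrt (W mn.1) : ℝ) : ℂ)‖ ^ 2 :=
    (summable_prod_of_nonneg (fun mn => by positivity)).2 ⟨hbrow, hbW⟩
  refine ⟨fun m => Real.sqrt (W m), fun mn => c mn / ((Real.sqrt (W mn.1) : ℝ) : ℂ),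
    fun m => Real.sqrt_nonneg _, ?_, ?_, ?_, hB, ?_⟩
  · intro m n
    by_cases h : W m = 0
    · have h1 : (2 * (m : ℝ) + 1) ^ r * ‖c (m, n)‖ ^ 2 ≤ W m :=
        (hrow m).le_tsum n fun k _ => hw0 (m, k)
      have h2 : 0 < (2 * (m : ℝ) + 1) ^ r := by positivity
      have h3 : ‖c (m, n)‖ ^ 2 ≤ 0 := by
        by_contra h4
        push Not at h4
        have := mul_pos h2 h4
        linarith
      have h5 : c (m, n) = 0 := by
        have := le_antisymm h3 (by positivity)
        simpa using this
      simp [h5]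
    · have : ((Real.sqrt (W m) : ℝ) : ℂ) ≠ 0 := by
        rw [Complex.ofReal_ne_zero]
        exact Real.sqrt_ne_zero'.2 (lt_of_le_of_ne (hW0 m) (Ne.symm h))
      exact (mul_div_cancel₀ _ this).symm
  · simp_rw [hsq]
    exact hW
  · simp_rw [hsq]
    exact (hc.tsum_prod' hrow).symm
  · rw [hB.tsum_prod' hbrow, ← hodd.tsum_eq]
    exact hbW.tsum_le_tsum hbsum hodd.summable
end
end
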